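/- arXiv:2310.15132 — 2 statements merged into one kernel-verified Lean document; each statement's English description precedes it below -/
import Mathlib

section
/- Let ρ : S^{m-1} → ℝ (the unit sphere of ℝ^m) be L-Lipschitz with ρ(l) ≥ 0 for all l, let ς ∈ ℝ^m, and let K := {ς + t • l : l ∈ S^{m-1}, 0 ≤ t ≤ ρ(l)} be the star-shaped set with star center ς and Minkowski gauge function ρ. Let Q : ℝ^m → ℝ^m be the affine map Q u = p + P u where P is an invertible linear map. Then the image Q '' K is again a star-shaped set with star center Q ς and Lipschitz Minkowski gauge function; that is, there exist L' ≥ 0 and an L'-Lipschitz function ρ' : S^{m-1} → ℝ with ρ'(l) ≥ 0 for all l, such that Q '' K = {Q ς + t • l : l ∈ S^{m-1}, 0 ≤ t ≤ ρ'(l)}. -/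
open Metric

theorem exists_forall_mem_sphere_abs_le {E : Type*} [NormedAddCommGroup E] {ρ : E → ℝ}
    {L : ℝ} (hL : 0 ≤ L)
    (hLip : ∀ l ∈ sphere (0 : E) 1, ∀ l' ∈ sphere (0 : E) 1, |ρ l - ρ l'| ≤ L * ‖l - l'‖) :
    ∃ B, 0 ≤ B ∧ ∀ l ∈ sphere (0 : E) 1, |ρ l| ≤ B := by
  rcases (sphere (0 : E) 1).eq_empty_or_nonempty with h | ⟨l₀, h₀⟩
  · exact ⟨0, le_rfl, by simp [h]⟩
  · refine ⟨|ρ l₀| + L * 2, by positivity, fun l hl => ?_⟩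
    have hd : ‖l - l₀‖ ≤ 2 := by
      have := norm_sub_le l l₀
      rw [mem_sphere_zero_iff_norm.1 hl, mem_sphere_zero_iff_norm.1 h₀] at this
      linarith
    have h₁ := (hLip l hl l₀ h₀).trans (mul_le_mul_of_nonneg_left hd hL)
    have h₂ := abs_sub_abs_le_abs_sub (ρ l) (ρ l₀)
    linarith

section StarShaped

variable {E F : Type*} [NormedAddCommGroup E] [NormedSpace ℝ E]
  [NormedAddCommGroup F] [NormedSpace ℝ F]

/-- The gauge on directions of `F` of the image under `e` of the star-shaped set with gauge `ρ`. -/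
noncomputable def imageGauge (e : E ≃L[ℝ] F) (ρ : E → ℝ) (l : F) : ℝ :=
  ‖e.symm l‖⁻¹ * ρ (‖e.symm l‖⁻¹ • e.symm l)

theorem inv_norm_smul_mem_sphere {x : E} (hx : x ≠ 0) : ‖x‖⁻¹ • x ∈ sphere (0 : E) 1 := by
  simp [norm_smul, hx]

theorem ContinuousLinearEquiv.symm_apply_ne_zero_of_mem_sphere (e : E ≃L[ℝ] F) {l : F}
    (hl : l ∈ sphere (0 : F) 1) : e.symm l ≠ 0 := by
  simpa using ne_zero_of_mem_unit_sphere (⟨l, hl⟩ : sphere (0 : F) 1)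

theorem ContinuousLinearEquiv.inv_norm_symm_le (e : E ≃L[ℝ] F) {l : F}
    (hl : l ∈ sphere (0 : F) 1) : ‖e.symm l‖⁻¹ ≤ ‖(e : E →L[ℝ] F)‖ := by
  have hpos : 0 < ‖e.symm l‖ := norm_pos_iff.2 (e.symm_apply_ne_zero_of_mem_sphere hl)
  rw [inv_le_iff_one_le_mul₀ hpos]
  have h := (e : E →L[ℝ] F).le_opNorm (e.symm l)
  simpa [mem_sphere_zero_iff_norm.1 hl] using h

theorem imageGauge_nonneg (e : E ≃L[ℝ] F) {ρ : E → ℝ} (hρ : ∀ l ∈ sphere (0 : E) 1, 0 ≤ ρ l)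
    {l : F} (hl : l ∈ sphere (0 : F) 1) : 0 ≤ imageGauge e ρ l :=
  mul_nonneg (by positivity)
    (hρ _ (inv_norm_smul_mem_sphere (e.symm_apply_ne_zero_of_mem_sphere hl)))

theorem exists_lipschitz_imageGauge (e : E ≃L[ℝ] F) {ρ : E → ℝ} {L : ℝ} (hL : 0 ≤ L)
    (hLip : ∀ l ∈ sphere (0 : E) 1, ∀ l' ∈ sphere (0 : E) 1, |ρ l - ρ l'| ≤ L * ‖l - l'‖) :
    ∃ L', 0 ≤ L' ∧ ∀ l ∈ sphere (0 : F) 1, ∀ l' ∈ sphere (0 : F) 1,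
      |imageGauge e ρ l - imageGauge e ρ l'| ≤ L' * ‖l - l'‖ := by
  obtain ⟨B, hB, hρB⟩ := exists_forall_mem_sphere_abs_le hL hLip
  set M := ‖(e : E →L[ℝ] F)‖
  set N := ‖(e.symm : F →L[ℝ] E)‖
  have hM : 0 ≤ M := norm_nonneg _
  have hN : 0 ≤ N := norm_nonneg _
  refine ⟨M * (L * (M * N + M * M * N * N)) + M * M * N * B, by positivity, fun l hl l' hl' => ?_⟩
  have hne := e.symm_apply_ne_zero_of_mem_sphere hl
  have hne' := e.symm_apply_ne_zero_of_mem_sphere hl'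
  have hn := inv_norm_smul_mem_sphere hne
  have hn' := inv_norm_smul_mem_sphere hne'
  have ha : ‖e.symm l‖⁻¹ ≤ M := e.inv_norm_symm_le hl
  have ha' : ‖e.symm l'‖⁻¹ ≤ M := e.inv_norm_symm_le hl'
  have hsub : ‖e.symm l - e.symm l'‖ ≤ N * ‖l - l'‖ := by
    simpa using (e.symm : F →L[ℝ] E).le_opNorm (l - l')
  have hnorm' : ‖e.symm l'‖ ≤ N := by
    simpa [mem_sphere_zero_iff_norm.1 hl'] using (e.symm : F →L[ℝ] E).le_opNorm l'
  have hρl' := hρB _ hn'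
  have hρsub := hLip _ hn _ hn'
  unfold imageGauge
  generalize e.symm l = v at *
  generalize e.symm l' = v' at *
  generalize ‖l - l'‖ = d at *
  have hinv : |‖v‖⁻¹ - ‖v'‖⁻¹| ≤ M * M * (N * d) := by
    have h : ‖v‖⁻¹ - ‖v'‖⁻¹ = ‖v‖⁻¹ * ‖v'‖⁻¹ * (‖v'‖ - ‖v‖) := by
      have := norm_ne_zero_iff.2 hne
      have := norm_ne_zero_iff.2 hne'
      field_simp
    rw [h, abs_mul, abs_of_nonneg (by positivity : 0 ≤ ‖v‖⁻¹ * ‖v'‖⁻¹), abs_sub_comm]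
    gcongr
    exact (abs_norm_sub_norm_le v v').trans hsub
  have hdir : ‖‖v‖⁻¹ • v - ‖v'‖⁻¹ • v'‖ ≤ M * (N * d) + M * M * (N * d) * N := by
    have h : ‖v‖⁻¹ • v - ‖v'‖⁻¹ • v' = ‖v‖⁻¹ • (v - v') + (‖v‖⁻¹ - ‖v'‖⁻¹) • v' := by
      module
    rw [h]
    refine (norm_add_le _ _).trans ?_
    rw [norm_smul, norm_smul, norm_inv, norm_norm, Real.norm_eq_abs]
    have := (abs_nonneg _).trans hinv
    gcongr
  generalize ρ (‖v‖⁻¹ • v) = r at *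
  generalize ρ (‖v'‖⁻¹ • v') = r' at *
  calc |‖v‖⁻¹ * r - ‖v'‖⁻¹ * r'|
      = |‖v‖⁻¹ * (r - r') + (‖v‖⁻¹ - ‖v'‖⁻¹) * r'| := by ring_nf
    _ ≤ ‖v‖⁻¹ * |r - r'| + |‖v‖⁻¹ - ‖v'‖⁻¹| * |r'| := by
      refine (abs_add_le _ _).trans ?_
      rw [abs_mul, abs_mul, abs_of_nonneg (by positivity : 0 ≤ ‖v‖⁻¹)]
    _ ≤ M * (L * (M * (N * d) + M * M * (N * d) * N)) + M * M * (N * d) * B := by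
      have := (abs_nonneg _).trans hinv
      have := hρsub.trans (mul_le_mul_of_nonneg_left hdir hL)
      gcongr
    _ = _ := by ring

theorem image_star_eq (e : E ≃L[ℝ] F) (ρ : E → ℝ) (ς : E) (p : F) :
    (fun u => p + e u) '' {x | ∃ l ∈ sphere (0 : E) 1, ∃ t : ℝ, 0 ≤ t ∧ t ≤ ρ l ∧ x = ς + t • l} =
      {x | ∃ l ∈ sphere (0 : F) 1, ∃ t : ℝ, 0 ≤ t ∧ t ≤ imageGauge e ρ l ∧
        x = (p + e ς) + t • l} := by
  ext x
  constructor
  · rintro ⟨_, ⟨l, hl, t, ht, htρ, rfl⟩, rfl⟩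
    have hnl := mem_sphere_zero_iff_norm.1 hl
    have hel : e l ≠ 0 := e.symm.symm_apply_ne_zero_of_mem_sphere hl
    have hpos : 0 < ‖e l‖ := norm_pos_iff.2 hel
    refine ⟨‖e l‖⁻¹ • e l, inv_norm_smul_mem_sphere hel, t * ‖e l‖, by positivity, ?_, ?_⟩
    · simp only [imageGauge, map_smul, e.symm_apply_apply, norm_smul, norm_inv, norm_norm, hnl,
        mul_one, inv_inv, smul_smul, mul_inv_cancel₀ hpos.ne', one_smul]
      nlinarith
    · simp [smul_smul, hpos.ne', add_assoc]
  · rintro ⟨l, hl, t, ht, htρ, rfl⟩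
    have hne := e.symm_apply_ne_zero_of_mem_sphere hl
    have hpos : 0 < ‖e.symm l‖ := norm_pos_iff.2 hne
    refine ⟨_, ⟨‖e.symm l‖⁻¹ • e.symm l, inv_norm_smul_mem_sphere hne, t * ‖e.symm l‖,
      by positivity, ?_, rfl⟩, ?_⟩
    · rwa [imageGauge, inv_mul_eq_div, le_div_iff₀ hpos] at htρ
    · simp [smul_smul, hpos.ne', add_assoc]

end StarShaped


/-- The image of a star-shaped set (with star center `ς` and
`L`-Lipschitz nonnegative Minkowski gauge function `ρ` on the unit sphere)
under an invertible affine map `Q u = p + P u` is again star-shaped with star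
center `Q ς` and some `L'`-Lipschitz nonnegative Minkowski gauge function. -/
theorem image_of_star_shaped_under_affine_map
    {m : ℕ} (ρ : EuclideanSpace ℝ (Fin m) → ℝ) (L : ℝ) (hL : 0 ≤ L)
    (hLip : ∀ l ∈ Metric.sphere (0 : EuclideanSpace ℝ (Fin m)) 1,
      ∀ l' ∈ Metric.sphere (0 : EuclideanSpace ℝ (Fin m)) 1,
        |ρ l - ρ l'| ≤ L * ‖l - l'‖)
    (hρ : ∀ l ∈ Metric.sphere (0 : EuclideanSpace ℝ (Fin m)) 1, 0 ≤ ρ l)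
    (ς : EuclideanSpace ℝ (Fin m))
    (K : Set (EuclideanSpace ℝ (Fin m)))
    (hK : K = {x | ∃ l ∈ Metric.sphere (0 : EuclideanSpace ℝ (Fin m)) 1,
      ∃ t : ℝ, 0 ≤ t ∧ t ≤ ρ l ∧ x = ς + t • l})
    (p : EuclideanSpace ℝ (Fin m))
    (P : EuclideanSpace ℝ (Fin m) ≃ₗ[ℝ] EuclideanSpace ℝ (Fin m)) :
    ∃ (L' : ℝ) (ρ' : EuclideanSpace ℝ (Fin m) → ℝ),
      0 ≤ L' ∧
      (∀ l ∈ Metric.sphere (0 : EuclideanSpace ℝ (Fin m)) 1,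
        ∀ l' ∈ Metric.sphere (0 : EuclideanSpace ℝ (Fin m)) 1,
          |ρ' l - ρ' l'| ≤ L' * ‖l - l'‖) ∧
      (∀ l ∈ Metric.sphere (0 : EuclideanSpace ℝ (Fin m)) 1, 0 ≤ ρ' l) ∧
      (fun u => p + P u) '' K =
        {x | ∃ l ∈ Metric.sphere (0 : EuclideanSpace ℝ (Fin m)) 1,
          ∃ t : ℝ, 0 ≤ t ∧ t ≤ ρ' l ∧ x = (p + P ς) + t • l} := by
  obtain ⟨L', hL', hLip'⟩ := exists_lipschitz_imageGauge P.toContinuousLinearEquiv hL hLip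
  refine ⟨L', imageGauge P.toContinuousLinearEquiv ρ, hL', hLip',
    fun l hl => imageGauge_nonneg _ hρ hl, ?_⟩
  rw [hK]
  exact image_star_eq P.toContinuousLinearEquiv ρ ς p
end

section
/- Let f : ℝ^n → ℝ^n and let g : ℝ^n → ℝ^{n×m} satisfy that g(x)ᵀ g(x) is invertible for every x. Let Q u = p + P u be an affine map on ℝ^m. Suppose we are given m+1 state–input pairs (x_0, u_0), …, (x_m, u_m) together with the corresponding degraded velocities y_j = f(x_j) + g(x_j) (Q u_j), such that the vectors u_1 - u_0, …, u_m - u_0 are linearly independent. Then Q is uniquely determined by this data: any affine map Q' u = p' + P' u satisfying y_j = f(x_j) + g(x_j) (Q' u_j) for all j = 0, …, m equals Q (i.e., p' = p and P' = P). -/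
open Matrix

/-- A matrix whose Gram matrix is invertible acts injectively on vectors. -/
theorem mulVec_injective_of_isUnit_det_transpose_mul_self {ι κ R : Type*} [Fintype ι] [Fintype κ]
    [DecidableEq κ] [CommRing R] {A : Matrix ι κ R} (hA : IsUnit (Aᵀ * A).det) :
    Function.Injective A.mulVec := by
  intro v w h
  apply mulVec_injective_of_isUnit ((isUnit_iff_isUnit_det _).2 hA)
  simp only [← mulVec_mulVec, h]

/-- Identifiability of a single affine control authority
degradation mode `Q u = p + P u` from `m+1` state–input–velocity observations
whose input differences `u_j - u_0` are linearly independent. -/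
theorem affine_cdm_identifiability
    {n m : ℕ} (f : (Fin n → ℝ) → (Fin n → ℝ))
    (g : (Fin n → ℝ) → Matrix (Fin n) (Fin m) ℝ)
    (hg : ∀ x, IsUnit ((g x)ᵀ * g x).det)
    (p : Fin m → ℝ) (P : Matrix (Fin m) (Fin m) ℝ)
    (x : Fin (m + 1) → (Fin n → ℝ)) (u : Fin (m + 1) → (Fin m → ℝ))
    (y : Fin (m + 1) → (Fin n → ℝ))
    (hy : ∀ j, y j = f (x j) + (g (x j)).mulVec (p + P.mulVec (u j)))
    (hli : LinearIndependent ℝ (fun j : Fin m => u j.succ - u 0)) :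
    ∀ (p' : Fin m → ℝ) (P' : Matrix (Fin m) (Fin m) ℝ),
      (∀ j, y j = f (x j) + (g (x j)).mulVec (p' + P'.mulVec (u j))) →
        p' = p ∧ P' = P := by
  intro p' P' hy'
  have hQ : ∀ j, p' + P' *ᵥ u j = p + P *ᵥ u j := fun j =>
    mulVec_injective_of_isUnit_det_transpose_mul_self (hg (x j))
      (add_left_cancel ((hy' j).symm.trans (hy j)))
  have hP : P' = P := by
    apply Matrix.toLin'.injective
    refine LinearMap.ext_on_range (hli.span_eq_top_of_card_eq_finrank' (by simp)) fun j => ?_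
    have hdiff := congrArg₂ (· - ·) (hQ j.succ) (hQ 0)
    simpa [mulVec_sub] using hdiff
  subst hP
  exact ⟨add_right_cancel (hQ 0), rfl⟩
end
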